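/- A finitely generated torsion class T in rep Q has a minimal generator, unique up to isomorphism, namely the direct sum of one representative of each isomorphism class of indecomposable T-split projective objects. -/

import Mathlib

open CategoryTheory CategoryTheory.Limits ZeroObject

attribute [local instance] CategoryTheory.Abelian.hasFiniteBiproducts

noncomputable section

namespace NCPaper

/-- A finite quiver without oriented cycles. -/
structure FinQuiver : Type 1 where
  V : Type
  [quiver : Quiver.{0} V]
  [fintypeV : Fintype V]
  [fintypeArr : ∀ a b : V, Fintype (a ⟶ b)]
  acyclic : ∀ (v : V) (p : Quiver.Path v v), p = Quiver.Path.nil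

attribute [instance] FinQuiver.quiver FinQuiver.fintypeV FinQuiver.fintypeArr

variable (k : Type) [Field k] (Q : FinQuiver)

/-- The ambient abelian category of all `k`-linear representations of `Q`;
finite-dimensional representations are singled out by the predicate `FinDim`. -/
abbrev RepC : Type 1 := Paths Q.V ⥤ ModuleCat.{0} k

variable {k Q}

/-- `M` is a finite-dimensional representation, i.e. an object of `rep Q`. -/
def FinDim (M : RepC k Q) : Prop :=
  ∀ v : Q.V, FiniteDimensional k (M.obj ((Paths.of Q.V).obj v))

section Cat

variable {C : Type*} [Category C] [Abelian C]

/-- `X` is a direct summand of `A`. -/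
def IsSummand (X A : C) : Prop := ∃ (i : X ⟶ A) (r : A ⟶ X), i ≫ r = 𝟙 X

/-- The additive closure of a set of objects: direct summands of finite direct sums. -/
def addSet (S : Set C) : Set C :=
  { X | ∃ (n : ℕ) (f : Fin n → C), (∀ i, f i ∈ S) ∧ IsSummand X (⨁ f) }

/-- `Gen S`: all quotients of objects of the additive closure of `S`. -/
def gen (S : Set C) : Set C := { X | ∃ A ∈ addSet S, ∃ p : A ⟶ X, Epi p }

/-- All morphisms from `A` to `B` vanish. -/
def HomZero (A B : C) : Prop := ∀ f : A ⟶ B, f = 0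

/-- `Ext¹(A, B) = 0`, expressed by the splitting of all short exact sequences
`0 ⟶ B ⟶ E ⟶ A ⟶ 0`. -/
def Ext1Zero (A B : C) : Prop :=
  ∀ (E : C) (i : B ⟶ E) (p : E ⟶ A) (w : i ≫ p = 0),
    (ShortComplex.mk i p w).ShortExact → ∃ r : E ⟶ B, i ≫ r = 𝟙 B

/-- An indecomposable object. -/
def Indec (X : C) : Prop :=
  ¬ IsZero X ∧ ∀ (A B : C), (X ≅ A ⊞ B) → IsZero A ∨ IsZero B

/-- A torsion class: a full subcategory (identified with its set of objects) closed under
direct sums, direct summands, quotients and extensions. -/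
structure IsTorsionClass (T : Set C) : Prop where
  zero_mem : (0 : C) ∈ T
  sum_mem : ∀ X ∈ T, ∀ Y ∈ T, (X ⊞ Y : C) ∈ T
  summand_mem : ∀ X ∈ T, ∀ Y : C, IsSummand Y X → Y ∈ T
  quot_mem : ∀ X ∈ T, ∀ (Y : C) (p : X ⟶ Y), Epi p → Y ∈ T
  ext_mem : ∀ S : ShortComplex C, S.ShortExact → S.X₁ ∈ T → S.X₃ ∈ T → S.X₂ ∈ T

/-- A wide subcategory: a full subcategory (closed under direct sums and summands)
which is exact abelian (closed under kernels and cokernels) and closed under extensions. -/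
structure IsWide (A : Set C) : Prop where
  zero_mem : (0 : C) ∈ A
  sum_mem : ∀ X ∈ A, ∀ Y ∈ A, (X ⊞ Y : C) ∈ A
  summand_mem : ∀ X ∈ A, ∀ Y : C, IsSummand Y X → Y ∈ A
  ker_mem : ∀ X ∈ A, ∀ Y ∈ A, ∀ f : X ⟶ Y, (kernel f : C) ∈ A
  coker_mem : ∀ X ∈ A, ∀ Y ∈ A, ∀ f : X ⟶ Y, (cokernel f : C) ∈ A
  ext_mem : ∀ S : ShortComplex C, S.ShortExact → S.X₁ ∈ A → S.X₃ ∈ A → S.X₂ ∈ A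

/-- `P` is split projective in the subcategory `T`: every epimorphism onto `P`
from an object of `T` splits. -/
def SplitProjIn (T : Set C) (P : C) : Prop :=
  P ∈ T ∧ ∀ X ∈ T, ∀ p : X ⟶ P, Epi p → ∃ s : P ⟶ X, s ≫ p = 𝟙 P

/-- `P` is Ext-projective in the subcategory `T`. -/
def ExtProjIn (T : Set C) (P : C) : Prop := P ∈ T ∧ ∀ X ∈ T, Ext1Zero P X

/-- The subcategory `a(T)` associated to a torsion class `T`. -/
def aSet (T : Set C) : Set C :=
  { B | B ∈ T ∧ ∀ Y ∈ T, ∀ g : Y ⟶ B, (kernel g : C) ∈ T }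

/-- A subcategory is finitely generated if it is generated by a single object of it. -/
def IsFinGen (T : Set C) : Prop := ∃ U ∈ T, T ⊆ gen {U}

/-- `U` is a generator of the subcategory `T`. -/
def IsGenerator (T : Set C) (U : C) : Prop := U ∈ T ∧ T ⊆ gen {U}

/-- `X` is a subquotient of `M`. -/
def IsSubquotient (X M : C) : Prop := ∃ (N : C) (i : N ⟶ M) (p : N ⟶ X), Mono i ∧ Epi p

/-- The support of `M` is contained in the support of `C0`: every simple subquotient
(composition factor) of `M` is a composition factor of `C0`. -/
def SuppLE (M C0 : C) : Prop := ∀ S : C, Simple S → IsSubquotient S M → IsSubquotient S C0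

/-- A partial tilting object of a hereditary category. -/
def IsPartialTilting (T : C) : Prop := Ext1Zero T T

/-- `T` is a tilting object of the full subcategory `A`: it is self-orthogonal and every
(split) projective object of `A` admits a coresolution `0 ⟶ P ⟶ T' ⟶ T'' ⟶ 0` with
`T', T'' ∈ add T`. For `A` the subcategory of representations supported on `supp T`,
this says exactly that `T` is a tilting `kQ/ann T`-module. -/
def TiltingIn (A : Set C) (T : C) : Prop :=
  T ∈ A ∧ Ext1Zero T T ∧
    ∀ P : C, SplitProjIn A P →
      ∃ (T' T'' : C) (_ : T' ∈ addSet {T}) (_ : T'' ∈ addSet {T})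
        (i : P ⟶ T') (p : T' ⟶ T'') (w : i ≫ p = 0),
        (ShortComplex.mk i p w).ShortExact


/-- `U` is the direct sum of one representative of each isomorphism class of
indecomposable Ext-projective objects of `T`. -/
def IsExtProjSum (T : Set C) (U : C) : Prop :=
  ∃ (n : ℕ) (f : Fin n → C),
    (∀ i, Indec (f i) ∧ ExtProjIn T (f i)) ∧
    (∀ i j, Nonempty (f i ≅ f j) → i = j) ∧
    (∀ P : C, Indec P → ExtProjIn T P → ∃ i, Nonempty (P ≅ f i)) ∧
    Nonempty (U ≅ ⨁ f)

/-- A basic object: a direct sum of pairwise non-isomorphic indecomposables. -/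
def IsBasic (U : C) : Prop :=
  ∃ (n : ℕ) (f : Fin n → C), (∀ i, Indec (f i)) ∧
    (∀ i j, Nonempty (f i ≅ f j) → i = j) ∧ Nonempty (U ≅ ⨁ f)

end Cat

/-- A support tilting object of `rep Q`: partial tilting, and tilting as a
`kQ/ann T`-module, i.e. tilting in the subcategory of all finite-dimensional
representations supported on the support of `T`. -/
def IsSupportTilting {k : Type} [Field k] {Q : FinQuiver} (T : RepC k Q) : Prop :=
  IsPartialTilting T ∧ TiltingIn { M : RepC k Q | FinDim M ∧ SuppLE M T } T

section Comb

/-- The dimension vector of a representation. -/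
def dimVec {k : Type} [Field k] {Q : FinQuiver} (M : RepC k Q) : Q.V → ℤ :=
  fun v => (Module.finrank k (M.obj ((Paths.of Q.V).obj v)) : ℤ)

/-- The Euler form of the quiver `Q`. -/
def euler (Q : FinQuiver) {R : Type} [CommRing R] (α β : Q.V → R) : R :=
  (∑ v : Q.V, α v * β v) - ∑ a : (Σ x : Q.V, Σ y : Q.V, x ⟶ y), α a.1 * β a.2.1

/-- The symmetrized Euler form of the quiver `Q`. -/
def symEuler (Q : FinQuiver) {R : Type} [CommRing R] (α β : Q.V → R) : R :=
  euler Q α β + euler Q β α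

/-- The reflection in the vector `v`: `s_v(w) = w - (v, w)·v`. -/
def reflV (Q : FinQuiver) (v : Q.V → ℤ) : (Q.V → ℤ) → (Q.V → ℤ) :=
  fun w => w - symEuler Q v w • v

/-- The composition (product, written from left to right) of a finite sequence of
linear transformations. -/
def comps (Q : FinQuiver) {m : ℕ} (g : Fin m → ((Q.V → ℤ) → (Q.V → ℤ))) :
    (Q.V → ℤ) → (Q.V → ℤ) :=
  (List.ofFn g).foldr (· ∘ ·) id

open scoped Classical in
/-- The simple root at a vertex. -/
def simRoot (Q : FinQuiver) (v : Q.V) : Q.V → ℤ := fun w => if w = v then 1 else 0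

/-- The simple reflection at a vertex. -/
def sref (Q : FinQuiver) (v : Q.V) : (Q.V → ℤ) → (Q.V → ℤ) := reflV Q (simRoot Q v)

/-- An enumeration of the vertices is compatible with the arrows of `Q` if sources
of arrows come before targets. -/
def OrdCompatible (Q : FinQuiver) (ord : Fin (Fintype.card Q.V) ≃ Q.V) : Prop :=
  ∀ (x y : Q.V), (x ⟶ y) → ord.symm x < ord.symm y

/-- The Coxeter element `cox(Q)`: the product of the simple reflections from left to
right in an order compatible with the arrows of `Q`. -/
def coxeter (Q : FinQuiver) (ord : Fin (Fintype.card Q.V) ≃ Q.V) :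
    (Q.V → ℤ) → (Q.V → ℤ) :=
  comps Q fun i => sref Q (ord i)

/-- The product of the simple reflections indexed by a word (a list of vertices). -/
def wordProd (Q : FinQuiver) (l : List Q.V) : (Q.V → ℤ) → (Q.V → ℤ) :=
  (l.map (sref Q)).foldr (· ∘ ·) id

/-- Membership in the Coxeter group `W` (realized faithfully on the root lattice). -/
def InW (Q : FinQuiver) (w : (Q.V → ℤ) → (Q.V → ℤ)) : Prop :=
  ∃ l : List Q.V, w = wordProd Q l

/-- The reflections of `W`: the conjugates of the simple reflections. -/
def IsRefl (Q : FinQuiver) (t : (Q.V → ℤ) → (Q.V → ℤ)) : Prop :=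
  ∃ (l : List Q.V) (i : Q.V), t = wordProd Q l ∘ sref Q i ∘ wordProd Q l.reverse

/-- The absolute length: the least length of an expression as a product of reflections. -/
def ellT (Q : FinQuiver) (w : (Q.V → ℤ) → (Q.V → ℤ)) : ℕ :=
  sInf { m | ∃ f : Fin m → ((Q.V → ℤ) → (Q.V → ℤ)), (∀ i, IsRefl Q (f i)) ∧ w = comps Q f }

/-- The absolute order on `W`. -/
def absLe (Q : FinQuiver) : ((Q.V → ℤ) → (Q.V → ℤ)) → ((Q.V → ℤ) → (Q.V → ℤ)) → Prop :=
  Relation.ReflTransGen fun u v => ∃ t, IsRefl Q t ∧ v = u ∘ t ∧ ellT Q v = ellT Q u + 1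

/-- The noncrossing partitions `NC_Q`: the interval `[e, cox(Q)]` in absolute order. -/
def NCSet (Q : FinQuiver) (ord : Fin (Fintype.card Q.V) ≃ Q.V) :
    Set ((Q.V → ℤ) → (Q.V → ℤ)) :=
  { w | InW Q w ∧ absLe Q w (coxeter Q ord) }

/-- `Q` is of finite (Dynkin) type: the symmetrized Euler form is positive definite. -/
def FiniteType (Q : FinQuiver) : Prop :=
  ∀ α : Q.V → ℚ, α ≠ 0 → 0 < symEuler Q α α

/-- `Q` is of affine (extended Dynkin) type: the symmetrized Euler form is positive
semidefinite with nontrivial radical. -/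
def AffineType (Q : FinQuiver) : Prop :=
  (∀ α : Q.V → ℚ, 0 ≤ symEuler Q α α) ∧ ∃ α : Q.V → ℚ, α ≠ 0 ∧ symEuler Q α α = 0

end Comb

section Statement1

variable {C : Type*} [Category C] [Abelian C]

/-- `U` is a minimal generator of the subcategory `T`: it generates `T`, and for every
direct sum decomposition `U ≅ U' ⊕ U''` with `U'` nonzero, `U'` is not generated
by `U''`. -/
def IsMinimalGenerator (T : Set C) (U : C) : Prop :=
  IsGenerator T U ∧
    ∀ (U' U'' : C), (U ≅ U' ⊞ U'') → ¬ IsZero U' → U' ∉ gen ({U''} : Set C)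

lemma exists_isCompl {X P : C} (i : P ⟶ X) (r : X ⟶ P) (h : i ≫ r = 𝟙 P) :
    ∃ (K : C) (i' : K ⟶ X) (r' : X ⟶ K), i' ≫ r' = 𝟙 K ∧ r ≫ i + r' ≫ i' = 𝟙 X ∧
      i ≫ r' = 0 ∧ i' ≫ r = 0 := by
  have hp : (𝟙 X - r ≫ i) ≫ (𝟙 X - r ≫ i) = 𝟙 X - r ≫ i := by
    simp [Preadditive.sub_comp, Preadditive.comp_sub, reassoc_of% h]
  obtain ⟨K, i', r', h1, h2⟩ := IsIdempotentComplete.idempotents_split X _ hp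
  refine ⟨K, i', r', h1, by rw [h2]; abel, ?_, ?_⟩
  · have : i ≫ r' ≫ i' ≫ r' = 0 := by
      rw [reassoc_of% h2]; simp [Preadditive.sub_comp, Preadditive.comp_sub, reassoc_of% h]
    simpa [h1] using this
  · have : i' ≫ r' ≫ i' ≫ r = 0 := by
      rw [reassoc_of% h2]; simp [Preadditive.sub_comp, Preadditive.comp_sub, h]
    simpa [reassoc_of% h1] using this

/-- Iso with a binary biproduct from the components. -/
lemma iso_biprod {X P K : C} (i : P ⟶ X) (r : X ⟶ P) (i' : K ⟶ X) (r' : X ⟶ K)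
    (h : i ≫ r = 𝟙 P) (h' : i' ≫ r' = 𝟙 K) (ht : r ≫ i + r' ≫ i' = 𝟙 X)
    (h1 : i ≫ r' = 0) (h2 : i' ≫ r = 0) : Nonempty (X ≅ P ⊞ K) :=
  ⟨{ hom := biprod.lift r r'
     inv := biprod.desc i i'
     hom_inv_id := by simpa using ht
     inv_hom_id := by
      ext <;> simp [h, h', h1, h2] }⟩

lemma indec_idem {X : C} (hX : Indec X) (e : X ⟶ X) (he : e ≫ e = e) : e = 0 ∨ e = 𝟙 X := by
  obtain ⟨A, i, r, h1, h2⟩ := IsIdempotentComplete.idempotents_split X e he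
  obtain ⟨K, i', r', h3, h4, h5, h6⟩ := exists_isCompl i r h1
  obtain ⟨φ⟩ := iso_biprod i r i' r' h1 h3 h4 h5 h6
  rcases hX.2 A K φ with h | h
  · left; rw [← h2, h.eq_zero_of_tgt r]; simp
  · right; rw [← h2, ← h4, h.eq_zero_of_tgt r']; simp

/-- A nonzero summand of an indecomposable is everything. -/
lemma indec_summand {X P : C} (hX : Indec X) (hP : ¬ IsZero P) (i : P ⟶ X) (r : X ⟶ P)
    (h : i ≫ r = 𝟙 P) : Nonempty (P ≅ X) := by
  rcases indec_idem hX (r ≫ i) (by simp [reassoc_of% h]) with h0 | h0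
  · exfalso
    apply hP
    rw [IsZero.iff_id_eq_zero]
    have : i ≫ (r ≫ i) ≫ r = 0 := by rw [h0]; simp
    simpa [h, reassoc_of% h] using this
  · exact ⟨⟨i, r, h, h0⟩⟩

lemma indec_of_iso {X Y : C} (e : X ≅ Y) (hX : Indec X) : Indec Y :=
  ⟨fun h => hX.1 (h.of_iso e), fun A B φ => hX.2 A B (e ≪≫ φ)⟩

variable {k : Type*} [Field k] [Linear k C]

lemma fitting_alg {A : Type*} [Ring A] [Algebra k A] [FiniteDimensional k A]
    (hA : ∀ e : A, e * e = e → e = 0 ∨ e = 1) (a : A) : IsUnit a ∨ IsNilpotent a := by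
  let B := Algebra.adjoin k ({a} : Set A)
  let : CommRing B := Algebra.adjoinCommRingOfComm k (by
    intro x hx y hy; simp only [Set.mem_singleton_iff] at hx hy; rw [hx, hy])
  have : FiniteDimensional k B := inferInstanceAs (FiniteDimensional k (Subalgebra.toSubmodule B))
  have : IsArtinianRing B := IsArtinianRing.of_finite k B
  let x : B := ⟨a, Algebra.subset_adjoin rfl⟩
  obtain ⟨n, y, hy⟩ := IsArtinian.exists_pow_succ_smul_dvd x (1 : B)
  simp only [smul_eq_mul, mul_one, Nat.succ_eq_add_one] at hy
  have key : ∀ m, x ^ n = x ^ (n + m) * y ^ m := by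
    intro m
    induction m with
    | zero => simp
    | succ m ih =>
      calc x ^ n = x ^ (n + m) * y ^ m := ih
        _ = x ^ n * (x ^ m * y ^ m) := by ring
        _ = (x ^ (n+1) * y) * (x ^ m * y ^ m) := by rw [hy]
        _ = _ := by ring
  have key' : x ^ (n+1) = x ^ (2 * (n+1)) * y ^ (n+1) := by
    calc x ^ (n+1) = x * x ^ n := by ring
      _ = x * (x ^ (n + (n+1)) * y ^ (n+1)) := by rw [← key]
      _ = _ := by ring
  set e : B := x ^ (n+1) * y ^ (n+1) with he
  have hee : e * e = e := by
    calc e * e = (x ^ (2 * (n+1)) * y ^ (n+1)) * y ^ (n+1) := by rw [he]; ring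
      _ = e := by rw [← key']
  have hxe : x ^ (n+1) = x ^ (n+1) * e := by
    rw [he]; conv_lhs => rw [key']
    ring
  have hBA : ∀ u v : B, ((u * v : B) : A) = (u : A) * (v : A) := fun u v => rfl
  rcases hA (e : A) (by rw [← hBA, hee]) with h | h
  · right
    have h0 : e = 0 := Subtype.ext h
    refine ⟨n+1, ?_⟩
    rw [h0, mul_zero] at hxe
    have := congrArg (fun b : B => (b : A)) hxe
    simpa [x] using this
  · left
    have h1 : e = 1 := Subtype.ext h
    have hx1 : x * (x ^ n * y ^ (n+1)) = 1 := by rw [← h1, he]; ring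
    have hx2 : (x ^ n * y ^ (n+1)) * x = 1 := by rw [← h1, he]; ring
    exact ⟨⟨a, ((x ^ n * y ^ (n+1) : B) : A), congrArg (fun b : B => (b : A)) hx1,
      congrArg (fun b : B => (b : A)) hx2⟩, rfl⟩

lemma fitting (k : Type*) [Field k] [Linear k C] {P : C} (hP : Indec P)
    [hfin : FiniteDimensional k (P ⟶ P)] (a : End P) :
    IsUnit a ∨ IsNilpotent a :=
  have : FiniteDimensional k (End P) := hfin
  fitting_alg (k := k) (A := End P) (fun e he => indec_idem hP e he) a

lemma indec_nontrivial {P : C} (hP : Indec P) : Nontrivial (End P) :=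
  ⟨⟨1, 0, fun h => hP.1 ((IsZero.iff_id_eq_zero P).2 h)⟩⟩

lemma indec_local (k : Type*) [Field k] [Linear k C] {P : C} (hP : Indec P)
    [hfin : FiniteDimensional k (P ⟶ P)] : IsLocalRing (End P) :=
  have := indec_nontrivial hP
  IsLocalRing.of_isUnit_or_isUnit_one_sub_self fun a =>
    (fitting k hP a).imp id fun h => h.isUnit_one_sub

lemma exists_unit_of_sum {R : Type*} [Ring R] [IsLocalRing R] {ι : Type*} (s : Finset ι)
    (a : ι → R) (h : IsUnit (∑ i ∈ s, a i)) : ∃ i ∈ s, IsUnit (a i) := by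
  classical
  induction s using Finset.induction_on with
  | empty => simp at h
  | insert i s hi ih =>
    rw [Finset.sum_insert hi] at h
    rcases IsLocalRing.isUnit_or_isUnit_of_isUnit_add h with h | h
    · exact ⟨i, by simp, h⟩
    · obtain ⟨j, hj, h⟩ := ih h
      exact ⟨j, by simp [hj], h⟩

/-- Trace criterion: no nonzero map out of `X` kills all maps from `Y`. -/
def Tr (Y X : C) : Prop := ∀ (Z : C) (b : X ⟶ Z), (∀ h : Y ⟶ X, h ≫ b = 0) → b = 0

lemma Tr.trans {W Y X : C} (h1 : Tr W Y) (h2 : Tr Y X) : Tr W X := fun Z b hb =>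
  h2 Z b fun h => h1 Z (h ≫ b) fun g => by rw [← Category.assoc]; exact hb _

lemma Tr.of_summand {Y X : C} (i : X ⟶ Y) (r : Y ⟶ X) (h : i ≫ r = 𝟙 X) : Tr Y X :=
  fun Z b hb => by
    have := hb r
    rw [← Category.id_comp b, ← h, Category.assoc, this, comp_zero]

lemma exists_epi_of_mem_gen {Y X : C} (h : X ∈ gen ({Y} : Set C)) :
    ∃ (n : ℕ) (p : (⨁ fun _ : Fin n => Y) ⟶ X), Epi p := by
  obtain ⟨A, ⟨n, f, hf, i, r, hir⟩, p, hp⟩ := h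
  obtain rfl : f = fun _ => Y := funext hf
  have : Epi r := by
    have : Epi (i ≫ r) := by rw [hir]; infer_instance
    exact epi_of_epi i r
  exact ⟨n, r ≫ p, epi_comp r p⟩

lemma Tr.of_mem_gen {Y X : C} (h : X ∈ gen ({Y} : Set C)) : Tr Y X := by
  obtain ⟨n, p, hp⟩ := exists_epi_of_mem_gen h
  intro Z b hb
  rw [← cancel_epi p, comp_zero]
  apply biproduct.hom_ext'
  intro j
  rw [← Category.assoc, hb, comp_zero]

lemma Tr.mem_gen (k : Type*) [Field k] [Linear k C] {Y X : C} [FiniteDimensional k (Y ⟶ X)]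
    (h : Tr Y X) : X ∈ gen ({Y} : Set C) := by
  let B := Module.finBasis k (Y ⟶ X)
  let φ : (⨁ fun _ : Fin (Module.finrank k (Y ⟶ X)) => Y) ⟶ X := biproduct.desc fun i => B i
  refine ⟨_, ⟨_, fun _ => Y, fun _ => rfl, 𝟙 _, 𝟙 _, by simp⟩, φ, ?_⟩
  apply Preadditive.epi_of_cancel_zero
  intro Z b hb
  apply h
  intro g
  have hB : ∀ i, B i ≫ b = 0 := fun i => by
    have : biproduct.ι _ i ≫ φ ≫ b = 0 := by rw [hb, comp_zero]
    simpa [φ] using this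
  rw [← B.sum_repr g, Preadditive.sum_comp]
  simp [hB]

section HomFin

/-- A surrogate for dimension. -/
def dd (k : Type*) [Field k] [Linear k C] (X : C) : ℕ := Module.finrank k (X ⟶ X)

lemma dd_pos (k : Type*) [Field k] [Linear k C] {X : C} [FiniteDimensional k (X ⟶ X)]
    (h : ¬ IsZero X) : 0 < dd k X := by
  have : Nontrivial (X ⟶ X) := ⟨⟨𝟙 X, 0, fun e => h ((IsZero.iff_id_eq_zero X).2 e)⟩⟩
  exact Module.finrank_pos

lemma dd_add (k : Type*) [Field k] [Linear k C] {X A B : C} [FiniteDimensional k (X ⟶ X)]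
    [FiniteDimensional k (A ⟶ A)] [FiniteDimensional k (B ⟶ B)]
    (e : X ≅ A ⊞ B) : dd k A + dd k B ≤ dd k X := by
  let L : (A ⟶ A) × (B ⟶ B) →ₗ[k] (X ⟶ X) :=
    { toFun := fun f => e.hom ≫ (biprod.fst ≫ f.1 ≫ biprod.inl + biprod.snd ≫ f.2 ≫ biprod.inr) ≫ e.inv
      map_add' := fun f g => by
        simp only [Prod.fst_add, Prod.snd_add, Preadditive.add_comp, Preadditive.comp_add]; abel
      map_smul' := fun c f => by
        simp [Preadditive.add_comp, Preadditive.comp_add] }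
  have hL : Function.Injective L := by
    rw [injective_iff_map_eq_zero]
    rintro ⟨f, g⟩ h
    have h' : e.hom ≫ (biprod.fst ≫ f ≫ biprod.inl + biprod.snd ≫ g ≫ biprod.inr) ≫ e.inv = 0 := h
    have h2 : (biprod.fst ≫ f ≫ biprod.inl + biprod.snd ≫ g ≫ biprod.inr : A ⊞ B ⟶ A ⊞ B) = 0 := by
      simpa only [Preadditive.IsIso.comp_left_eq_zero, Preadditive.IsIso.comp_right_eq_zero] using h'
    have h3 : biprod.inl ≫ (biprod.fst ≫ f ≫ biprod.inl + biprod.snd ≫ g ≫ biprod.inr : A ⊞ B ⟶ A ⊞ B) ≫ biprod.fst = 0 := by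
      rw [h2]; simp
    have h4 : biprod.inr ≫ (biprod.fst ≫ f ≫ biprod.inl + biprod.snd ≫ g ≫ biprod.inr : A ⊞ B ⟶ A ⊞ B) ≫ biprod.snd = 0 := by
      rw [h2]; simp
    simp [Preadditive.add_comp] at h3 h4
    simp [h3, h4]
  have := LinearMap.finrank_le_finrank_of_injective hL
  rwa [Module.finrank_prod] at this

lemma summand_left {X A B : C} (e : X ≅ A ⊞ B) : IsSummand A X :=
  ⟨biprod.inl ≫ e.inv, e.hom ≫ biprod.fst, by simp⟩

lemma summand_right {X A B : C} (e : X ≅ A ⊞ B) : IsSummand B X :=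
  ⟨biprod.inr ≫ e.inv, e.hom ≫ biprod.snd, by simp⟩

variable {T : Set C}

/-- Biproducts over a disjoint union. -/
def sumIso {ι κ : Type} [Fintype ι] [Fintype κ] (F : ι ⊕ κ → C) :
    ((⨁ fun i => F (Sum.inl i)) ⊞ (⨁ fun i => F (Sum.inr i))) ≅ ⨁ F where
  hom := biprod.desc (biproduct.desc fun i => biproduct.ι F (Sum.inl i))
          (biproduct.desc fun i => biproduct.ι F (Sum.inr i))
  inv := biproduct.desc fun j => Sum.rec
          (motive := fun j => F j ⟶ ((⨁ fun i => F (Sum.inl i)) ⊞ (⨁ fun i => F (Sum.inr i))))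
          (fun i => biproduct.ι (fun i => F (Sum.inl i)) i ≫ biprod.inl)
          (fun i => biproduct.ι (fun i => F (Sum.inr i)) i ≫ biprod.inr) j
  hom_inv_id := by
    apply biprod.hom_ext' <;> apply biproduct.hom_ext' <;> intro j <;> simp
  inv_hom_id := by
    apply biproduct.hom_ext'
    rintro (i | i) <;> simp

lemma exists_decomp (k : Type*) [Field k] [Linear k C] (hT : IsTorsionClass T)
    (hfin : ∀ X ∈ T, ∀ Y ∈ T, FiniteDimensional k (X ⟶ Y)) :
    ∀ (d : ℕ) (X : C), X ∈ T → dd k X = d → ∃ (ι : Type) (_ : Fintype ι) (f : ι → C),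
      (∀ i, Indec (f i)) ∧ Nonempty (X ≅ ⨁ f) := by
  intro d
  induction d using Nat.strong_induction_on with
  | _ d ih =>
  intro X hX hd
  by_cases h0 : IsZero X
  · refine ⟨Empty, inferInstance, Empty.elim, fun i => i.elim, ⟨h0.iso ?_⟩⟩
    rw [IsZero.iff_id_eq_zero]
    apply biproduct.hom_ext
    intro j; exact j.elim
  by_cases h1 : Indec X
  · refine ⟨Unit, inferInstance, fun _ => X, fun _ => h1,
      ⟨⟨biproduct.ι (fun _ : Unit => X) (), biproduct.π (fun _ : Unit => X) (), by simp, ?_⟩⟩⟩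
    apply biproduct.hom_ext
    intro j
    simp
  have h2 : ∃ (A B : C) (_ : X ≅ A ⊞ B), ¬ IsZero A ∧ ¬ IsZero B := by
    by_contra hc
    push Not at hc
    refine h1 ⟨h0, fun A B e => ?_⟩
    by_cases hA : IsZero A
    · exact Or.inl hA
    · exact Or.inr (hc A B e hA)
  obtain ⟨A, B, e, hA0, hB0⟩ := h2
  have hA := hT.summand_mem X hX A (summand_left e)
  have hB := hT.summand_mem X hX B (summand_right e)
  have := hfin A hA A hA
  have := hfin B hB B hB
  have := hfin X hX X hX
  have hadd := dd_add k e
  have hpA := dd_pos k hA0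
  have hpB := dd_pos k hB0
  obtain ⟨ι, _, f, hf, ⟨eA⟩⟩ := ih (dd k A) (by omega) A hA rfl
  obtain ⟨κ, _, g, hg, ⟨eB⟩⟩ := ih (dd k B) (by omega) B hB rfl
  classical
  refine ⟨ι ⊕ κ, inferInstance, Sum.elim f g, ?_, ⟨e ≪≫ biprod.mapIso eA eB ≪≫ ?_⟩⟩
  · rintro (i | i)
    · exact hf i
    · exact hg i
  · exact sumIso (Sum.elim f g)

lemma exists_decomp_fin (k : Type*) [Field k] [Linear k C] (hT : IsTorsionClass T)
    (hfin : ∀ X ∈ T, ∀ Y ∈ T, FiniteDimensional k (X ⟶ Y)) (X : C) (hX : X ∈ T) :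
    ∃ (n : ℕ) (f : Fin n → C), (∀ i, Indec (f i)) ∧ Nonempty (X ≅ ⨁ f) := by
  obtain ⟨ι, _, f, hf, ⟨e⟩⟩ := exists_decomp k hT hfin _ X hX rfl
  refine ⟨Fintype.card ι, fun i => f ((Fintype.equivFin ι).symm i), fun i => hf _,
    ⟨e ≪≫ biproduct.whiskerEquiv (Fintype.equivFin ι) fun j => eqToIso (by simp)⟩⟩

lemma biproduct_mem (hT : IsTorsionClass T) : ∀ (n : ℕ) (f : Fin n → C), (∀ i, f i ∈ T) →
    (⨁ f : C) ∈ T := by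
  intro n
  induction n with
  | zero =>
    intro f _
    refine hT.quot_mem 0 hT.zero_mem _ 0 ⟨fun g h _ => ?_⟩
    apply biproduct.hom_ext'
    intro j; exact j.elim0
  | succ n ih =>
    intro f hf
    refine hT.quot_mem _ (hT.sum_mem _ (hf 0) _ (ih (fun i => f i.succ) fun i => hf _)) _
      (biprod.desc (biproduct.ι f 0) (biproduct.desc fun i => biproduct.ι f i.succ))
      ⟨fun g h hgh => ?_⟩
    apply biproduct.hom_ext'
    intro j
    refine Fin.cases ?_ (fun i => ?_) j
    · simpa using congrArg (fun t => biprod.inl ≫ t) hgh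
    · simpa using congrArg (fun t => biproduct.ι (fun i : Fin n => f i.succ) i ≫ biprod.inr ≫ t) hgh

/-- Indecomposable summands of a minimal generator are split projective. -/
lemma splitProj_of_summand (k : Type*) [Field k] [Linear k C] (hT : IsTorsionClass T)
    (hfin : ∀ X ∈ T, ∀ Y ∈ T, FiniteDimensional k (X ⟶ Y)) {U P : C}
    (hU : IsMinimalGenerator T U) (hP : Indec P) (i : P ⟶ U) (r : U ⟶ P) (hir : i ≫ r = 𝟙 P) :
    SplitProjIn T P := by
  have hPT : P ∈ T := hT.summand_mem U hU.1.1 P ⟨i, r, hir⟩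
  refine ⟨hPT, fun X hX p hp => ?_⟩
  obtain ⟨K, i', r', h1, h2, h3, h4⟩ := exists_isCompl i r hir
  obtain ⟨φ⟩ := iso_biprod i r i' r' hir h1 h2 h3 h4
  have hKT : K ∈ T := hT.summand_mem U hU.1.1 K ⟨i', r', h1⟩
  have hnot := hU.2 P K φ hP.1
  have := hfin P hPT P hPT
  have := hfin K hKT P hPT
  by_contra hns
  have hnil : ∀ h : U ⟶ X, ¬ IsUnit (show End P from i ≫ h ≫ p) := by
    intro h hu
    apply hns
    have : IsIso (i ≫ h ≫ p) := (isUnit_iff_isIso _).1 hu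
    exact ⟨inv (i ≫ h ≫ p) ≫ i ≫ h, by simp⟩
  apply hnot
  apply Tr.mem_gen k
  intro Z b hb
  -- replace `Z` by the image of `b`, which lies in `T`
  by_contra hb0
  let Q := Abelian.image b
  let b0 : P ⟶ Q := Abelian.factorThruImage b
  have hQT : Q ∈ T := hT.quot_mem P hPT Q b0 inferInstance
  have := hfin P hPT Q hQT
  have hb0' : b0 ≠ 0 := fun h => hb0 (by rw [← Abelian.image.fac b]; change b0 ≫ _ = 0; rw [h, zero_comp])
  let V : Set (P ⟶ Q) := {c | (∀ h : K ⟶ P, h ≫ c = 0) ∧ c ≠ 0}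
  have hV : b0 ∈ V := ⟨fun h => by
    rw [← cancel_mono (Abelian.image.ι b)]
    have := hb h
    simpa [b0] using this, hb0'⟩
  let S : (P ⟶ Q) → Submodule k (P ⟶ Q) := fun c =>
    LinearMap.range (Linear.rightComp k P c)
  obtain ⟨c, hc, hmin⟩ := (InvImage.wf (fun c => Module.finrank k (S c)) Nat.lt_wfRel.wf).has_min
    V ⟨b0, hV⟩
  -- find `h` with `i ≫ h ≫ p ≫ c ≠ 0`
  have hex : ∃ h : U ⟶ X, (i ≫ h ≫ p) ≫ c ≠ 0 := by
    by_contra hcon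
    push Not at hcon
    apply hc.2
    rw [← cancel_epi p, comp_zero]
    apply Tr.of_mem_gen (hU.1.2 hX)
    intro h
    have e1 : i ≫ h ≫ p ≫ c = 0 := by simpa using hcon h
    have e2 : i' ≫ h ≫ p ≫ c = 0 := by simpa using hc.1 (i' ≫ h ≫ p)
    rw [← Category.id_comp (h ≫ p ≫ c), ← h2]
    simp [Preadditive.add_comp, e1, e2]
  obtain ⟨h, hh⟩ := hex
  set a : P ⟶ P := i ≫ h ≫ p with ha
  have hac : a ≫ c ∈ V := ⟨fun g => by rw [← Category.assoc]; exact hc.1 _, hh⟩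
  have hle : S (a ≫ c) ≤ S c := by
    rintro _ ⟨g, rfl⟩
    exact ⟨g ≫ a, by simp⟩
  have heq : S (a ≫ c) = S c :=
    Submodule.eq_of_le_of_finrank_le hle (not_lt.1 (hmin _ hac))
  have hcm : c ∈ S (a ≫ c) := by
    rw [heq]; exact ⟨𝟙 P, by simp⟩
  obtain ⟨g, hg⟩ := hcm
  have hg' : g ≫ a ≫ c = c := hg
  -- `g ≫ a` is not a unit
  rcases fitting k hP (show End P from g ≫ a) with hu | hn
  · have := indec_nontrivial hP
    have : IsIso (g ≫ a) := (isUnit_iff_isIso _).1 hu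
    rcases fitting k hP (show End P from a) with hu' | hn'
    · exact hnil h hu'
    · -- `a` has a left inverse and is nilpotent
      obtain ⟨m, hm⟩ := hn'
      let u : End P := (show End P from inv (g ≫ a) ≫ g)
      have hau : (show End P from a) * u = 1 := by
        change (inv (g ≫ a) ≫ g) ≫ a = 𝟙 P
        simp
      have : ∀ m : ℕ, (show End P from a) ^ m * u ^ m = 1 := by
        intro m
        induction m with
        | zero => simp
        | succ m ih =>
          rw [pow_succ, pow_succ', mul_assoc, ← mul_assoc _ u, hau, one_mul, ih]
      have h5 := this m
      rw [hm, zero_mul] at h5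
      exact zero_ne_one h5
  · have hu := hn.isUnit_one_sub
    have : IsIso (𝟙 P - g ≫ a) := (isUnit_iff_isIso _).1 hu
    apply hc.2
    rw [← cancel_epi (𝟙 P - g ≫ a)]
    simp [Preadditive.sub_comp, hg']

lemma structure_min (k : Type*) [Field k] [Linear k C] (hT : IsTorsionClass T)
    (hfin : ∀ X ∈ T, ∀ Y ∈ T, FiniteDimensional k (X ⟶ Y)) {U : C}
    (hU : IsMinimalGenerator T U) :
    ∃ (n : ℕ) (f : Fin n → C),
        (∀ i, Indec (f i) ∧ SplitProjIn T (f i)) ∧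
        (∀ i j, Nonempty (f i ≅ f j) → i = j) ∧
        (∀ P : C, Indec P → SplitProjIn T P → ∃ i, Nonempty (P ≅ f i)) ∧
        Nonempty (U ≅ ⨁ f) := by
  obtain ⟨n, f, hf, ⟨e⟩⟩ := exists_decomp_fin k hT hfin U hU.1.1
  have hio : ∀ i, (biproduct.ι f i ≫ e.inv) ≫ (e.hom ≫ biproduct.π f i) = 𝟙 _ := by
    intro i; simp
  have hfT : ∀ i, f i ∈ T := fun i => hT.summand_mem U hU.1.1 _ ⟨_, _, hio i⟩
  refine ⟨n, f, fun i => ⟨hf i, splitProj_of_summand k hT hfin hU (hf i) _ _ (hio i)⟩,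
    ?_, ?_, ⟨e⟩⟩
  · rintro i j ⟨φ⟩
    by_contra hij
    obtain ⟨K, i', r', h1, h2, h3, h4⟩ := exists_isCompl _ _ (hio i)
    obtain ⟨ψ⟩ := iso_biprod _ _ i' r' (hio i) h1 h2 h3 h4
    have hKT : K ∈ T := hT.summand_mem U hU.1.1 K ⟨i', r', h1⟩
    refine hU.2 _ K ψ (hf i).1 ?_
    have := hfin K hKT (f i) (hfT i)
    apply Tr.mem_gen k
    refine Tr.of_summand (φ.hom ≫ biproduct.ι f j ≫ e.inv ≫ r')
      (i' ≫ e.hom ≫ biproduct.π f j ≫ φ.inv) ?_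
    have h5 : r' ≫ i' = 𝟙 U - (e.hom ≫ biproduct.π f i) ≫ (biproduct.ι f i ≫ e.inv) := by
      rw [← h2]; abel
    simp only [Category.assoc]
    rw [reassoc_of% h5]
    simp [Preadditive.sub_comp, Preadditive.comp_sub, biproduct.ι_π_ne_assoc f (Ne.symm hij)]
  · intro P hP hPs
    have := hfin P hPs.1 P hPs.1
    obtain ⟨m, p, hp⟩ := exists_epi_of_mem_gen (hU.1.2 hPs.1)
    obtain ⟨s, hs⟩ := hPs.2 _ (biproduct_mem hT m (fun _ => U) fun _ => hU.1.1) p hp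
    have := indec_local k hP
    let a : Fin m × Fin n → End P := fun x =>
      (s ≫ biproduct.π (fun _ => U) x.1 ≫ e.hom ≫ biproduct.π f x.2) ≫
        (biproduct.ι f x.2 ≫ e.inv ≫ biproduct.ι (fun _ => U) x.1 ≫ p)
    have hsum : ∑ x, a x = (𝟙 P : P ⟶ P) := by
      rw [← hs, Fintype.sum_prod_type]
      have h6 : ∀ l : Fin m, ∑ j : Fin n, a (l, j) =
          s ≫ (biproduct.π (fun _ => U) l ≫ biproduct.ι (fun _ => U) l) ≫ p := by
        intro l
        have h7 : biproduct.π (fun _ : Fin m => U) l ≫ biproduct.ι (fun _ => U) l =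
          biproduct.π (fun _ => U) l ≫ e.hom ≫ (∑ j, biproduct.π f j ≫ biproduct.ι f j) ≫
            e.inv ≫ biproduct.ι (fun _ => U) l := by
          rw [biproduct.total]; simp
        rw [h7]
        simp only [a, Preadditive.sum_comp, Preadditive.comp_sum, Category.assoc]
      simp only [h6]
      rw [← Preadditive.comp_sum, ← Preadditive.sum_comp, biproduct.total]
      simp
    obtain ⟨x, -, hx⟩ := exists_unit_of_sum Finset.univ a (by
      rw [hsum]; exact isUnit_one)
    have : IsIso (a x) := (isUnit_iff_isIso _).1 hx
    refine ⟨x.2, indec_summand (hf x.2) hP.1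
      (s ≫ biproduct.π (fun _ => U) x.1 ≫ e.hom ≫ biproduct.π f x.2)
      ((biproduct.ι f x.2 ≫ e.inv ≫ biproduct.ι (fun _ => U) x.1 ≫ p) ≫ inv (a x)) ?_⟩
    rw [← Category.assoc]
    exact IsIso.hom_inv_id (a x)

theorem main_abstract (k : Type*) [Field k] [Linear k C] (hT : IsTorsionClass T)
    (hfin : ∀ X ∈ T, ∀ Y ∈ T, FiniteDimensional k (X ⟶ Y)) (hfg : IsFinGen T) :
    ∃ U : C, IsMinimalGenerator T U ∧
      (∀ U' : C, IsMinimalGenerator T U' → Nonempty (U' ≅ U)) ∧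
      ∃ (n : ℕ) (f : Fin n → C),
        (∀ i, Indec (f i) ∧ SplitProjIn T (f i)) ∧
        (∀ i j, Nonempty (f i ≅ f j) → i = j) ∧
        (∀ P : C, Indec P → SplitProjIn T P → ∃ i, Nonempty (P ≅ f i)) ∧
        Nonempty (U ≅ ⨁ f) := by
  obtain ⟨U0, hU0⟩ := hfg
  obtain ⟨U, hU, hmin⟩ := (InvImage.wf (fun X : C => dd k X) Nat.lt_wfRel.wf).has_min
    {U | IsGenerator T U} ⟨U0, hU0⟩
  have hUm : IsMinimalGenerator T U := by
    refine ⟨hU, fun A B e hA hgen => ?_⟩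
    have hAT := hT.summand_mem U hU.1 A (summand_left e)
    have hBT := hT.summand_mem U hU.1 B (summand_right e)
    have := hfin A hAT A hAT
    have := hfin B hBT B hBT
    have := hfin U hU.1 U hU.1
    have hTrA := Tr.of_mem_gen hgen
    have hTrU : Tr B U := by
      intro Z b hb
      have h1 : (biprod.inl ≫ e.inv) ≫ b = 0 := hTrA Z _ fun h => by
        rw [← Category.assoc]; exact hb _
      have h2 : (biprod.inr ≫ e.inv) ≫ b = 0 := hb _
      rw [← cancel_epi e.inv, comp_zero]
      apply biprod.hom_ext'
      · simpa using h1
      · simpa using h2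
    refine hmin B ⟨hBT, fun X hX => ?_⟩ ?_
    · have := hfin B hBT X hX
      exact Tr.mem_gen k (hTrU.trans (Tr.of_mem_gen (hU.2 hX)))
    · have := dd_add k e
      have := dd_pos k hA
      change dd k B < dd k U
      omega
  obtain ⟨n, f, h1, h2, h3, ⟨e⟩⟩ := structure_min k hT hfin hUm
  refine ⟨U, hUm, fun U' hU' => ?_, n, f, h1, h2, h3, ⟨e⟩⟩
  obtain ⟨m, g, g1, g2, g3, ⟨e'⟩⟩ := structure_min k hT hfin hU'
  choose σ hσ using fun j => h3 (g j) (g1 j).1 (g1 j).2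
  choose τ hτ using fun j => g3 (f j) (h1 j).1 (h1 j).2
  let E : Fin m ≃ Fin n :=
    { toFun := σ
      invFun := τ
      left_inv := fun j => (g2 _ _ ⟨(hσ j).some ≪≫ (hτ (σ j)).some⟩).symm
      right_inv := fun j => (h2 _ _ ⟨(hτ j).some ≪≫ (hσ (τ j)).some⟩).symm }
  exact ⟨e' ≪≫ biproduct.whiskerEquiv E (fun j => (hσ j).some.symm) ≪≫ e.symm⟩

end HomFin

lemma finDim_hom {k : Type} [Field k] {Q : FinQuiver} {M N : RepC k Q} (hM : FinDim M)
    (hN : FinDim N) : FiniteDimensional k (M ⟶ N) := by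
  let L : (M ⟶ N) →ₗ[k] (∀ v : Q.V, (M.obj ((Paths.of Q.V).obj v)) →ₗ[k]
      (N.obj ((Paths.of Q.V).obj v))) :=
    { toFun := fun α v => (α.app ((Paths.of Q.V).obj v)).hom
      map_add' := fun _ _ => rfl
      map_smul' := fun _ _ => rfl }
  have := fun v => hM v
  have := fun v => hN v
  refine FiniteDimensional.of_injective L fun α β h => ?_
  ext v x
  have := congrFun h v
  exact congrArg (fun t => t x) this

/-- A finitely generated torsion class `T` in `rep Q` has a minimal
generator, unique up to isomorphism, namely the direct sum of one representative of
each isomorphism class of indecomposable `T`-split projective objects. -/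
theorem statement1 (k : Type) [Field k] [IsAlgClosed k] (Q : FinQuiver)
    (T : Set (RepC k Q)) (hT : IsTorsionClass T) (hfd : ∀ X ∈ T, FinDim X)
    (hfg : IsFinGen T) :
    ∃ U : RepC k Q, IsMinimalGenerator T U ∧
      (∀ U' : RepC k Q, IsMinimalGenerator T U' → Nonempty (U' ≅ U)) ∧
      ∃ (n : ℕ) (f : Fin n → RepC k Q),
        (∀ i, Indec (f i) ∧ SplitProjIn T (f i)) ∧
        (∀ i j, Nonempty (f i ≅ f j) → i = j) ∧
        (∀ P : RepC k Q, Indec P → SplitProjIn T P → ∃ i, Nonempty (P ≅ f i)) ∧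
        Nonempty (U ≅ ⨁ f) := by
  exact main_abstract k hT (fun X hX Y hY => finDim_hom (hfd X hX) (hfd Y hY)) hfg

end Statement1
end NCPaper
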